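/- For all integers n ≥ 0 and k ≥ 1, the number of lattice paths of length 2n that stay in the strip [-k, k] and end at height 0 is equal to the number of lattice paths of length 2n that stay in the strip [0, 2k] (with no restriction on the final height). -/

import Mathlib

/-- The height of a lattice path `s : Fin n → ℤ` after `j` steps:
the sum of the first `j` steps. -/
def pathHeight {n : ℕ} (s : Fin n → ℤ) (j : ℕ) : ℤ :=
  ∑ i ∈ Finset.univ.filter (fun i : Fin n => (i : ℕ) < j), s i

/-- The number of lattice paths of length `n` (steps `±1`) whose height stays in
`[a, b]` at every time `0 ≤ j ≤ n` and whose final height lies in `E`. -/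
noncomputable def pathCount (n : ℕ) (a b : ℤ) (E : Set ℤ) : ℕ :=
  Nat.card {s : Fin n → ℤ //
    (∀ i, s i ∈ ({1, -1} : Set ℤ)) ∧
    (∀ j ≤ n, pathHeight s j ∈ Set.Icc a b) ∧
    pathHeight s n ∈ E}

theorem pathHeight_zero {n : ℕ} (s : Fin n → ℤ) : pathHeight s 0 = 0 := by
  simp [pathHeight]

theorem pathHeight_cons_succ {n : ℕ} (c : ℤ) (t : Fin n → ℤ) (j : ℕ) :
    pathHeight (Fin.cons c t : Fin (n + 1) → ℤ) (j + 1) = c + pathHeight t j := by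
  simp [pathHeight, Finset.sum_filter, Fin.sum_univ_succ]

/-- The set of lattice paths counted by `pathCount`. -/
def pathSet (n : ℕ) (a b : ℤ) (E : Set ℤ) : Set (Fin n → ℤ) :=
  {s | (∀ i, s i ∈ ({1, -1} : Set ℤ)) ∧
    (∀ j ≤ n, pathHeight s j ∈ Set.Icc a b) ∧ pathHeight s n ∈ E}

theorem pathCount_eq_ncard (n : ℕ) (a b : ℤ) (E : Set ℤ) :
    pathCount n a b E = (pathSet n a b E).ncard := rfl

theorem pathSet_finite (n : ℕ) (a b : ℤ) (E : Set ℤ) : (pathSet n a b E).Finite := by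
  refine (Set.Finite.pi' (t := fun _ : Fin n => ({1, -1} : Set ℤ)) fun _ => ?_).subset
    fun s hs => hs.1
  simp

theorem cons_mem_pathSet {n : ℕ} {a b c : ℤ} {E : Set ℤ} {t : Fin n → ℤ} :
    (Fin.cons c t : Fin (n + 1) → ℤ) ∈ pathSet (n + 1) a b E ↔
      c ∈ ({1, -1} : Set ℤ) ∧ (0 : ℤ) ∈ Set.Icc a b ∧
        t ∈ pathSet n (a - c) (b - c) {z | c + z ∈ E} := by
  have hstrip : (∀ j ≤ n + 1, pathHeight (Fin.cons c t : Fin (n + 1) → ℤ) j ∈ Set.Icc a b) ↔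
      (0 : ℤ) ∈ Set.Icc a b ∧ ∀ j ≤ n, pathHeight t j ∈ Set.Icc (a - c) (b - c) := by
    constructor
    · intro h
      refine ⟨by simpa only [pathHeight_zero] using h 0 (by lia), fun j hj => ?_⟩
      have := h (j + 1) (by lia)
      rw [pathHeight_cons_succ, Set.mem_Icc] at this
      rw [Set.mem_Icc]
      lia
    · rintro ⟨h0, h⟩ (_ | j) hj
      · rwa [pathHeight_zero]
      · have := h j (by lia)
        rw [Set.mem_Icc] at this
        rw [pathHeight_cons_succ, Set.mem_Icc]
        lia
  simp only [pathSet, Set.mem_ofPred_eq, hstrip, pathHeight_cons_succ, Fin.forall_fin_succ,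
    Fin.cons_zero, Fin.cons_succ]
  tauto

theorem pathCount_zero (a b : ℤ) (E : Set ℤ) [Decidable ((0 : ℤ) ∈ Set.Icc a b ∧ (0 : ℤ) ∈ E)] :
    pathCount 0 a b E = if (0 : ℤ) ∈ Set.Icc a b ∧ (0 : ℤ) ∈ E then 1 else 0 := by
  have h : pathSet 0 a b E = {_s | (0 : ℤ) ∈ Set.Icc a b ∧ (0 : ℤ) ∈ E} := by
    ext s
    simp [pathSet, pathHeight_zero]
  rw [pathCount_eq_ncard, h]
  split_ifs with h'
  · simp only [h', and_self, Set.ofPred_true, Set.ncard_univ, Nat.card_unique]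
  · simp only [h', Set.ofPred_false, Set.ncard_empty]

theorem pathCount_succ (n : ℕ) {a b : ℤ} (E : Set ℤ) (h0 : (0 : ℤ) ∈ Set.Icc a b) :
    pathCount (n + 1) a b E =
      pathCount n (a - 1) (b - 1) {z | 1 + z ∈ E} +
        pathCount n (a - -1) (b - -1) {z | -1 + z ∈ E} := by
  have hU : pathSet (n + 1) a b E =
      (fun t => (Fin.cons 1 t : Fin (n + 1) → ℤ)) '' pathSet n (a - 1) (b - 1) {z | 1 + z ∈ E} ∪
      (fun t => (Fin.cons (-1) t : Fin (n + 1) → ℤ)) ''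
        pathSet n (a - -1) (b - -1) {z | -1 + z ∈ E} := by
    ext s
    induction s using Fin.consCases with
    | cons c t =>
      simp only [cons_mem_pathSet, Set.mem_union, Set.mem_image, Fin.cons_inj, h0, true_and,
        Set.mem_insert_iff, Set.mem_singleton_iff]
      constructor
      · rintro ⟨rfl | rfl, ht⟩
        · exact Or.inl ⟨t, ht, rfl, rfl⟩
        · exact Or.inr ⟨t, ht, rfl, rfl⟩
      · rintro (⟨t, ht, rfl, rfl⟩ | ⟨t, ht, rfl, rfl⟩)
        · exact ⟨Or.inl rfl, ht⟩
        · exact ⟨Or.inr rfl, ht⟩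
  have hD : Disjoint
      ((fun t => (Fin.cons 1 t : Fin (n + 1) → ℤ)) '' pathSet n (a - 1) (b - 1) {z | 1 + z ∈ E})
      ((fun t => (Fin.cons (-1) t : Fin (n + 1) → ℤ)) ''
        pathSet n (a - -1) (b - -1) {z | -1 + z ∈ E}) := by
    rw [Set.disjoint_left]
    rintro _ ⟨t, -, rfl⟩ ⟨t', -, h⟩
    simp [Fin.cons_inj] at h
  have hinj (c : ℤ) : Function.Injective fun t : Fin n → ℤ => (Fin.cons c t : Fin (n + 1) → ℤ) :=
    Fin.cons_right_injective (α := fun _ => ℤ) c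
  simp only [pathCount_eq_ncard]
  rw [hU, Set.ncard_union_eq hD ((pathSet_finite _ _ _ _).image _)
      ((pathSet_finite _ _ _ _).image _),
    Set.ncard_image_of_injective _ (hinj _), Set.ncard_image_of_injective _ (hinj _)]

theorem pathCount_of_zero_notMem (n : ℕ) {a b : ℤ} (E : Set ℤ) (h0 : (0 : ℤ) ∉ Set.Icc a b) :
    pathCount n a b E = 0 := by
  have : pathSet n a b E = ∅ := by
    ext s
    simp only [Set.mem_empty_iff_false, iff_false]
    exact fun hs => h0 (by simpa only [pathHeight_zero] using hs.2.1 0 n.zero_le)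
  rw [pathCount_eq_ncard, this, Set.ncard_empty]

/-- The sum of the values of `f` at the end points of the `N` step paths started at `x`. -/
def walkSum (f : ℤ → ℤ) : ℕ → ℤ → ℤ
  | 0, x => f x
  | N + 1, x => walkSum f N (x + 1) + walkSum f N (x - 1)

theorem walkSum_reflect {f : ℤ → ℤ} {c : ℤ} (hf : ∀ x, f (c - x) = -f x) (N : ℕ) (x : ℤ) :
    walkSum f N (c - x) = -walkSum f N x := by
  induction N generalizing x with
  | zero => exact hf x
  | succ N ih =>
    have h1 := ih (x + 1)
    have h2 := ih (x - 1)
    rw [show c - (x + 1) = c - x - 1 by ring] at h1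
    rw [show c - (x - 1) = c - x + 1 by ring] at h2
    simp only [walkSum, h1, h2]
    ring

theorem walkSum_eq_zero_of_reflect {f : ℤ → ℤ} {c : ℤ} (hf : ∀ x, f (2 * c - x) = -f x) (N : ℕ) :
    walkSum f N c = 0 := by
  have h := walkSum_reflect hf N c
  rw [show 2 * c - c = c by ring] at h
  lia

/-- The reflection principle for a strip: paths in `[a, b]` started at `x` are counted by a
`walkSum` whose weight is odd about `a - 1` and `b + 1` and restricts to the indicator of the
allowed end points on `[a, b]`. -/
theorem pathCount_eq_walkSum {f : ℤ → ℤ} {a b : ℤ} {E : Set ℤ} [DecidablePred (· ∈ E)]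
    (ha : ∀ x, f (2 * (a - 1) - x) = -f x) (hb : ∀ x, f (2 * (b + 1) - x) = -f x)
    (hf : ∀ x ∈ Set.Icc a b, f x = if x ∈ E then 1 else 0)
    (N : ℕ) {x : ℤ} (hx : x ∈ Set.Icc (a - 1) (b + 1)) :
    (pathCount N (a - x) (b - x) {z | x + z ∈ E} : ℤ) = walkSum f N x := by
  induction N generalizing x with
  | zero =>
    by_cases hab : x ∈ Set.Icc a b
    · have h0 : (0 : ℤ) ∈ Set.Icc (a - x) (b - x) := by
        rw [Set.mem_Icc] at hab ⊢
        lia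
      classical
      rw [pathCount_zero, walkSum, hf x hab]
      simp only [h0, Set.mem_ofPred_eq, add_zero, true_and]
      split_ifs <;> simp
    · rw [pathCount_of_zero_notMem _ _ (by rw [Set.mem_Icc] at hab ⊢; lia), Nat.cast_zero]
      rw [Set.mem_Icc] at hx hab
      obtain rfl | rfl : x = a - 1 ∨ x = b + 1 := by lia
      · exact (walkSum_eq_zero_of_reflect ha _).symm
      · exact (walkSum_eq_zero_of_reflect hb _).symm
  | succ N ih =>
    by_cases hab : x ∈ Set.Icc a b
    · have h0 : (0 : ℤ) ∈ Set.Icc (a - x) (b - x) := by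
        rw [Set.mem_Icc] at hab ⊢
        lia
      rw [Set.mem_Icc] at hab
      rw [pathCount_succ _ _ h0, walkSum, ← ih (x := x + 1) (by rw [Set.mem_Icc]; lia),
        ← ih (x := x - 1) (by rw [Set.mem_Icc]; lia)]
      push_cast
      simp only [Set.mem_ofPred_eq, ← add_assoc, ← sub_eq_add_neg, sub_sub]
    · rw [pathCount_of_zero_notMem _ _ (by rw [Set.mem_Icc] at hab ⊢; lia), Nat.cast_zero]
      rw [Set.mem_Icc] at hx hab
      obtain rfl | rfl : x = a - 1 ∨ x = b + 1 := by lia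
      · exact (walkSum_eq_zero_of_reflect ha _).symm
      · exact (walkSum_eq_zero_of_reflect hb _).symm

/-- If the backward difference by two of `f` agrees with `2 * g` on the even integers, this
persists for the walk sums, on the integers of the parity of the number of steps. -/
theorem walkSum_sub_walkSum_sub_two {f g : ℤ → ℤ}
    (h : ∀ x, Even x → f x - f (x - 2) = 2 * g x) (N : ℕ) {x : ℤ} (hx : Even (x + N)) :
    walkSum f N x - walkSum f N (x - 2) = 2 * walkSum g N x := by
  induction N generalizing x with
  | zero => exact h x (by simpa using hx)
  | succ N ih =>
    have h1 := ih (x := x + 1) (by push_cast at hx; convert hx using 1; ring)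
    have h2 := ih (x := x - 1) (by
      push_cast at hx
      rw [show x - 1 + (N : ℤ) = x + (N + 1) - 2 by ring]
      exact hx.sub even_two)
    rw [show x + 1 - 2 = x - 2 + 1 by ring] at h1
    rw [show x - 1 - 2 = x - 2 - 1 by ring] at h2
    simp only [walkSum]
    lia

/-- The odd extension of the constant `1` on `[0, 2 * k]`, of period `4 * k + 4`. -/
def squareWave (k : ℕ) (x : ℤ) : ℤ :=
  if x % (4 * k + 4) ≤ 2 * k then 1
  else if x % (4 * k + 4) = 2 * k + 1 ∨ x % (4 * k + 4) = 4 * k + 3 then 0 else -1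

/-- The odd extension of the unit mass at `0` on `[-k, k]`, of period `4 * k + 4`. -/
def alternatingComb (k : ℕ) (x : ℤ) : ℤ :=
  if x % (4 * k + 4) = 0 then 1 else if x % (4 * k + 4) = 2 * k + 2 then -1 else 0

theorem Int.sub_emod_of_lt {M c : ℤ} (hc : 0 ≤ c) (hcM : c < M) (x : ℤ) :
    (c - x) % M = if x % M ≤ c then c - x % M else c - x % M + M := by
  have h0 := Int.emod_nonneg x (show M ≠ 0 by lia)
  have h1 := Int.emod_lt_of_pos x (show 0 < M by lia)
  rw [← Int.sub_emod_emod]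
  split_ifs with h
  · exact Int.emod_eq_of_lt (by lia) (by lia)
  · rw [← Int.add_emod_right]
    exact Int.emod_eq_of_lt (by lia) (by lia)

theorem Int.sub_emod_period {M c : ℤ} (x : ℤ) : (c - M - x) % M = (c - x) % M := by
  rw [show c - M - x = c - x - M by ring, Int.sub_emod_right]

theorem squareWave_reflect (k : ℕ) (x : ℤ) :
    squareWave k (4 * k + 2 - x) = -squareWave k x := by
  have h0 := Int.emod_nonneg x (show (4 * k + 4 : ℤ) ≠ 0 by lia)
  have h1 := Int.emod_lt_of_pos x (show (0 : ℤ) < 4 * k + 4 by lia)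
  simp only [squareWave, Int.sub_emod_of_lt (show (0 : ℤ) ≤ 4 * k + 2 by lia)
    (show (4 * k + 2 : ℤ) < 4 * k + 4 by lia)]
  generalize x % (4 * k + 4 : ℤ) = r at *
  split_ifs <;> lia

theorem squareWave_reflect_neg (k : ℕ) (x : ℤ) :
    squareWave k (-2 - x) = -squareWave k x := by
  rw [← squareWave_reflect]
  simp only [squareWave, show (-2 : ℤ) = 4 * k + 2 - (4 * k + 4) by ring, Int.sub_emod_period]

theorem alternatingComb_reflect (k : ℕ) (x : ℤ) :
    alternatingComb k (2 * k + 2 - x) = -alternatingComb k x := by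
  have h0 := Int.emod_nonneg x (show (4 * k + 4 : ℤ) ≠ 0 by lia)
  have h1 := Int.emod_lt_of_pos x (show (0 : ℤ) < 4 * k + 4 by lia)
  simp only [alternatingComb, Int.sub_emod_of_lt (show (0 : ℤ) ≤ 2 * k + 2 by lia)
    (show (2 * k + 2 : ℤ) < 4 * k + 4 by lia)]
  generalize x % (4 * k + 4 : ℤ) = r at *
  split_ifs <;> lia

theorem alternatingComb_reflect_neg (k : ℕ) (x : ℤ) :
    alternatingComb k (-(2 * k + 2) - x) = -alternatingComb k x := by
  rw [← alternatingComb_reflect]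
  simp only [alternatingComb, show (-(2 * k + 2) : ℤ) = 2 * k + 2 - (4 * k + 4) by ring,
    Int.sub_emod_period]

theorem squareWave_sub_squareWave_sub_two (k : ℕ) {x : ℤ} (hx : Even x) :
    squareWave k x - squareWave k (x - 2) = 2 * alternatingComb k x := by
  have h0 := Int.emod_nonneg x (show (4 * k + 4 : ℤ) ≠ 0 by lia)
  have h1 := Int.emod_lt_of_pos x (show (0 : ℤ) < 4 * k + 4 by lia)
  have h2 : x % (4 * k + 4) % 2 = 0 := by
    rw [Int.emod_emod_of_dvd x ⟨2 * k + 2, by ring⟩, Int.even_iff.mp hx]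
  rw [show x - 2 = -2 - -x by ring, squareWave_reflect_neg]
  simp only [squareWave, alternatingComb, show -x = 0 - x by ring,
    Int.sub_emod_of_lt le_rfl (show (0 : ℤ) < 4 * k + 4 by lia)]
  generalize x % (4 * k + 4 : ℤ) = r at *
  split_ifs <;> lia

theorem pathCount_univ_eq_walkSum (k N : ℕ) :
    (pathCount N 0 (2 * k) Set.univ : ℤ) = walkSum (squareWave k) N 0 := by
  classical
  have h := pathCount_eq_walkSum (f := squareWave k) (a := 0) (b := 2 * k) (E := Set.univ)
    (fun x => squareWave_reflect_neg k x)
    (fun x => by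
      rw [show 2 * (2 * k + 1 : ℤ) = 4 * k + 2 by ring]
      exact squareWave_reflect k x)
    (fun x hx => by
      rw [Set.mem_Icc] at hx
      rw [squareWave, Int.emod_eq_of_lt hx.1 (by lia)]
      simp [hx.2]) N (x := 0) (by rw [Set.mem_Icc]; lia)
  simpa using h

theorem pathCount_zero_eq_walkSum (k N : ℕ) :
    (pathCount N (-k) k {0} : ℤ) = walkSum (alternatingComb k) N 0 := by
  classical
  have h := pathCount_eq_walkSum (f := alternatingComb k) (a := -k) (b := k) (E := {0})
    (fun x => by
      rw [show 2 * (-k - 1 : ℤ) = -(2 * k + 2) by ring]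
      exact alternatingComb_reflect_neg k x)
    (fun x => by
      rw [show 2 * (k + 1 : ℤ) = 2 * k + 2 by ring]
      exact alternatingComb_reflect k x)
    (fun x hx => by
      rw [Set.mem_Icc] at hx
      simp only [alternatingComb, Set.mem_singleton_iff]
      rcases le_or_gt 0 x with h | h
      · rw [Int.emod_eq_of_lt h (by lia)]
        split_ifs <;> lia
      · rw [← Int.add_emod_right, Int.emod_eq_of_lt (by lia) (by lia)]
        split_ifs <;> lia) N (x := 0) (by rw [Set.mem_Icc]; lia)
  simpa using h

theorem stmt_1 (n k : ℕ) (hk : 1 ≤ k) :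
    pathCount (2 * n) (-(k : ℤ)) (k : ℤ) ({0} : Set ℤ)
      = pathCount (2 * n) 0 (2 * k : ℤ) Set.univ := by
  have h := walkSum_sub_walkSum_sub_two
    (fun _ hx => squareWave_sub_squareWave_sub_two k hx) (2 * n) (x := 0) (by simp)
  have h' := walkSum_reflect (squareWave_reflect_neg k) (2 * n) 0
  have h₁ := pathCount_univ_eq_walkSum k (2 * n)
  have h₂ := pathCount_zero_eq_walkSum k (2 * n)
  rw [show (0 : ℤ) - 2 = -2 - 0 by ring, h', ← h₁, ← h₂] at h
  lia
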